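/- Let M > 0 and α ∈ (0,1] with M - α + 1 ≤ 3(1+α)/(6α+4). If F is analytic on the unit disk with F(0) = 0, F'(0) = 1, and Re((1-α)F'(z) + α z F''(z)) > -M for all z in the unit disk, then Re(F(z)/z) > 1/2 for all z in the unit disk (with F(z)/z interpreted as F'(0) = 1 at z = 0). -/

import Mathlib

open Metric Complex

theorem coef_avg (q : ℂ → ℂ) (hq : DifferentiableOn ℂ q (ball 0 1)) (r : ℝ) (hr0 : 0 < r)
    (hr1 : r < 1) (z : ℂ) (k : ℕ) :
    Real.circleAverage (fun ζ => (z / ζ) ^ k * q ζ) 0 r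
      = (k.factorial : ℂ)⁻¹ * (z ^ k * iteratedDeriv k q 0) := by
  lift r to NNReal using hr0.le
  have hr0' : 0 < r := by exact_mod_cast hr0
  have h := (hq.mono (closedBall_subset_ball hr1)).hasFPowerSeriesOnBall hr0'
  have h1 := h.factorial_smul z k
  rw [cauchyPowerSeries_apply, iteratedFDeriv_apply_eq_iteratedDeriv_mul_prod] at h1
  rw [Real.circleAverage_eq_circleIntegral (by exact_mod_cast hr0.ne')]
  have hk : (k.factorial : ℂ) ≠ 0 := by exact_mod_cast k.factorial_ne_zero
  rw [eq_inv_mul_iff_mul_eq₀ hk]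
  simp only [nsmul_eq_mul, Finset.prod_const, Finset.card_univ, Fintype.card_fin, smul_eq_mul] at h1 ⊢
  rw [← h1]
  congr 3
  funext ζ
  ring

theorem conj_avg (q : ℂ → ℂ) (hq : DifferentiableOn ℂ q (ball 0 1)) (r : ℝ) (hr0 : 0 < r)
    (hr1 : r < 1) (z : ℂ) (k : ℕ) :
    Real.circleAverage (fun ζ => (starRingEnd ℂ (z / ζ)) ^ k * q ζ) 0 r
      = if k = 0 then q 0 else 0 := by
  have e : Real.circleAverage (fun ζ => (starRingEnd ℂ (z / ζ)) ^ k * q ζ) 0 r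
      = Real.circleAverage (fun ζ => (starRingEnd ℂ z * ζ / r ^ 2) ^ k * q ζ) 0 r := by
    apply Real.circleAverage_congr_sphere
    intro ζ hζ
    have hn : ‖ζ‖ = r := by simpa [abs_of_pos hr0] using hζ
    have hζ0 : ζ ≠ 0 := by rintro rfl; simp at hn; linarith
    have hc : starRingEnd ℂ ζ ≠ 0 := by simpa using hζ0
    have hm : ζ * starRingEnd ℂ ζ = (r:ℂ) ^ 2 := by
      rw [Complex.mul_conj, Complex.normSq_eq_norm_sq, hn]; push_cast; rfl
    have hr : (r:ℂ) ≠ 0 := by exact_mod_cast hr0.ne'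
    show _ ^ k * _ = _ ^ k * _
    congr 2
    rw [map_div₀, ← hm]
    field_simp
  rw [e, DiffContOnCl.circleAverage]
  · by_cases hk : k = 0 <;> simp [hk]
  · rw [abs_of_pos hr0]
    apply DifferentiableOn.diffContOnCl
    rw [closure_ball _ hr0.ne']
    have := hq.mono (closedBall_subset_ball hr1)
    fun_prop

/-- partial geometric sums -/
theorem geo_id (w : ℂ) (N : ℕ) :
    ‖∑ k ∈ Finset.range (N + 1), w ^ k‖ ^ 2 - ‖w‖ ^ 2 * ‖∑ k ∈ Finset.range N, w ^ k‖ ^ 2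
     = 2 * (∑ k ∈ Finset.range (N + 1), w ^ k).re - 1 := by
  rw [Finset.sum_range_succ']
  have : ∑ k ∈ Finset.range N, w ^ (k + 1) = w * ∑ k ∈ Finset.range N, w ^ k := by
    rw [Finset.mul_sum]; simp [pow_succ']
  rw [this]
  set s := ∑ k ∈ Finset.range N, w ^ k
  simp only [← Complex.normSq_eq_norm_sq, Complex.normSq_apply]
  simp
  ring

theorem exists_A (q : ℂ → ℂ) (hq : DifferentiableOn ℂ q (ball 0 1))
    (hpos : ∀ z ∈ ball (0:ℂ) 1, 0 < (q z).re) (z : ℂ) (hz : ‖z‖ < 1) :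
    ∃ (A : ℕ → ℝ) (ρ : ℝ), 0 ≤ ρ ∧ ρ < 1 ∧ (∀ n, 0 ≤ A n) ∧ A 0 = 0 ∧
      ∀ N, (∑ k ∈ Finset.range (N + 1), (k.factorial : ℂ)⁻¹ * (z ^ k * iteratedDeriv k q 0)).re
        = A (N + 1) - ρ * A N := by
  obtain ⟨r, hzr, hr1⟩ := exists_between hz
  have hr0 : 0 < r := (norm_nonneg z).trans_lt hzr
  have hsph : ∀ ζ ∈ sphere (0:ℂ) |r|, ‖ζ‖ = r ∧ ζ ≠ 0 ∧ ζ ∈ ball (0:ℂ) 1 := by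
    intro ζ hζ
    have hn : ‖ζ‖ = r := by simpa [abs_of_pos hr0] using hζ
    refine ⟨hn, ?_, by simpa [hn] using hr1⟩
    rintro rfl; simp at hn; linarith
  have hqc : ContinuousOn q (sphere (0:ℂ) |r|) := hq.continuousOn.mono fun ζ h => (hsph ζ h).2.2
  have hdc : ContinuousOn (fun ζ : ℂ => z / ζ) (sphere (0:ℂ) |r|) :=
    continuousOn_const.div continuousOn_id fun ζ h => (hsph ζ h).2.1
  refine ⟨fun N => Real.circleAverage
    (fun ζ => (q ζ).re * ‖∑ k ∈ Finset.range N, (z / ζ) ^ k‖ ^ 2) 0 r, (‖z‖ / r) ^ 2, by positivity,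
    ?_, ?_, ?_, ?_⟩
  · rw [sq_lt_one_iff₀ (by positivity), div_lt_one hr0]; exact hzr
  · intro n
    apply Real.circleAverage_nonneg_of_nonneg
    intro ζ hζ
    have := hpos ζ (hsph ζ hζ).2.2
    positivity
  · simp [Real.circleAverage_const]
  · intro N
    have hsum : ∑ k ∈ Finset.range (N + 1), (k.factorial : ℂ)⁻¹ * (z ^ k * iteratedDeriv k q 0)
      = Real.circleAverage (fun ζ => (∑ k ∈ Finset.range (N + 1), (z / ζ) ^ k * q ζ)
        + (∑ k ∈ Finset.range (N + 1), starRingEnd ℂ (z / ζ) ^ k * q ζ) - q ζ) 0 r := by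
      rw [Real.circleAverage_fun_sub, Real.circleAverage_fun_add, Real.circleAverage_fun_sum,
        Real.circleAverage_fun_sum]
      · simp only [coef_avg q hq r hr0 hr1, conj_avg q hq r hr0 hr1]
        have := conj_avg q hq r hr0 hr1 z 0
        simp only [pow_zero, one_mul, if_true] at this
        rw [show Real.circleAverage q 0 r = q 0 from this]
        simp
      all_goals
        intros
        apply ContinuousOn.circleIntegrable'
        fun_prop
    rw [hsum]
    have hint : ∀ n, CircleIntegrable
        (fun ζ => (q ζ).re * ‖∑ k ∈ Finset.range n, (z / ζ) ^ k‖ ^ 2) 0 r := by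
      intro n
      apply ContinuousOn.circleIntegrable'
      fun_prop
    rw [← smul_eq_mul, ← Real.circleAverage_fun_smul, ← Real.circleAverage_fun_sub (hint _)
      ((hint N).const_fun_smul (a := (‖z‖ / r) ^ 2))]
    rw [← Complex.reCLM_apply, ← ContinuousLinearMap.circleAverage_comp_comm]
    · apply Real.circleAverage_congr_sphere
      intro ζ hζ
      have h := geo_id (z / ζ) N
      rw [norm_div, (hsph ζ hζ).1] at h
      simp only [Function.comp, Complex.reCLM_apply, smul_eq_mul]
      have e2 : (q ζ).re * ‖∑ k ∈ Finset.range (N + 1), (z / ζ) ^ k‖ ^ 2 -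
        (‖z‖ / r) ^ 2 * ((q ζ).re * ‖∑ k ∈ Finset.range N, (z / ζ) ^ k‖ ^ 2)
        = (q ζ).re * (2 * (∑ k ∈ Finset.range (N + 1), (z / ζ) ^ k).re - 1) := by
        rw [← h]; ring
      rw [e2]
      simp only [← Finset.sum_mul, ← map_pow, ← map_sum]
      generalize ∑ k ∈ Finset.range (N + 1), (z / ζ) ^ k = s
      simp
      ring
    · apply ContinuousOn.circleIntegrable'
      fun_prop

theorem conv_aux (x y α : ℝ) (hx : 0 < x) (hy : 0 < y) (hα : 0 < α) :
    2 / ((x + 1) * (y + α)) ≤ 1 / (x * y) + 1 / ((x + 2) * (y + 2 * α)) := by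
  rw [div_add_div _ _ (by positivity) (by positivity), div_le_div_iff₀ (by positivity) (by positivity)]
  have : 0 < x * y := by positivity
  have : 0 < α * x := by positivity
  have : 0 < x * x * α * α := by positivity
  nlinarith [mul_pos hα hα, mul_pos hα hy, mul_pos hy hy, mul_pos (mul_pos hα hα) hx]

/-- the multiplier sequence -/
noncomputable def cs (β α : ℝ) (k : ℕ) : ℝ :=
  if k = 0 then 1 else 2 * β / (((k:ℝ) + 1) * (1 + α * ((k:ℝ) - 1)))

theorem cs_tendsto (β α : ℝ) (hβ : 0 < β) (hα : 0 < α) :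
    Filter.Tendsto (cs β α) Filter.atTop (nhds 0) := by
  have h := (tendsto_one_div_add_atTop_nhds_zero_nat (𝕜 := ℝ)).const_mul (2 * β)
  rw [mul_zero] at h
  refine tendsto_of_tendsto_of_tendsto_of_le_of_le' tendsto_const_nhds h ?_ ?_ <;>
  · filter_upwards [Filter.eventually_ge_atTop 1] with k hk
    have hk' : (1:ℝ) ≤ k := by exact_mod_cast hk
    have : 0 ≤ α * ((k:ℝ) - 1) := mul_nonneg hα.le (by linarith)
    rw [cs, if_neg (by omega)]
    first
    | positivity
    | rw [mul_one_div]
      apply div_le_div_of_nonneg_left (by positivity) (by positivity)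
      nlinarith

theorem cs_anti (β α : ℝ) (hβ : 0 < β) (hα : 0 < α)
    (h : β * (6 * α + 4) ≤ 3 * (1 + α)) (k : ℕ) :
    cs β α (k + 1) - cs β α (k + 2) ≤ cs β α k - cs β α (k + 1) := by
  rcases k with _ | k
  · simp only [cs]
    norm_num
    have : 2 * β / (3 * (1 + α)) = β * (2 / (3 * (1 + α))) := by ring
    have h2 : (2 * β - 1) ≤ 2 * β / (3 * (1 + α)) := by
      rw [le_div_iff₀ (by positivity)]
      nlinarith
    linarith
  · have h1 := conv_aux ((k:ℝ) + 2) (1 + α * k) α (by positivity) (by positivity) hα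
    simp only [cs]
    norm_num
    have e1 : 2 * β / (((k:ℝ) + 1 + 1) * (1 + α * k)) = 2 * β * (1 / (((k:ℝ) + 2) * (1 + α * k))) := by
      rw [mul_one_div]; ring_nf
    have e2 : 2 * β / (((k:ℝ) + 1 + 1 + 1) * (1 + α * (k + 1))) = β * (2 / (((k:ℝ) + 2 + 1) * (1 + α * k + α))) := by
      rw [mul_div_assoc']; ring_nf
    have e3 : 2 * β / (((k:ℝ) + 1 + 2 + 1) * (1 + α * (k + 1 + 2 - 1))) = 2 * β * (1 / (((k:ℝ) + 2 + 2) * (1 + α * k + 2 * α))) := by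
      rw [mul_one_div]; ring_nf
    rw [e1, e2, e3]
    nlinarith

theorem abel_lower (c : ℕ → ℝ) (hc : ∀ k, c (k + 1) - c (k + 2) ≤ c k - c (k + 1))
    (τ A : ℕ → ℝ) (ρ : ℝ) (h0 : 0 ≤ ρ) (h1 : ρ < 1) (hA : ∀ n, 0 ≤ A n) (hA0 : A 0 = 0)
    (hcn : ∀ k, 0 ≤ c k - c (k + 1))
    (hτ0 : τ 0 = 0) (hτ : ∀ N, τ (N + 1) = A (N + 1) - ρ * A N) (N : ℕ) :
    ρ * (c N - c (N + 1)) * A (N + 1) + (1 - ρ) * (c 0 - c 1) * A 1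
      ≤ ∑ k ∈ Finset.range (N + 1), c k * (τ (k + 1) - τ k) - c (N + 1) * τ (N + 1) := by
  induction N with
  | zero => simp [hτ0, hτ, hA0]; nlinarith
  | succ N ih =>
    rw [Finset.sum_range_succ]
    have a := hτ (N + 1)
    have b := mul_nonneg (mul_nonneg (sub_nonneg.2 (hc N)) (hA (N + 1))) h0
    have d := mul_nonneg (mul_nonneg (hcn (N + 1)) (hA (N + 2))) (sub_nonneg.2 h1.le)
    have e : (c (N + 1) - c (N + 2)) * τ (N + 2) = (c (N + 1) - c (N + 2)) * (A (N + 2) - ρ * A (N + 1)) := by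
      rw [a]
    simp only [add_assoc, Nat.reduceAdd] at *
    nlinarith

theorem cs_nonneg_diff (β α : ℝ) (hβ : 0 < β) (hα : 0 < α)
    (h : β * (6 * α + 4) ≤ 3 * (1 + α)) (k : ℕ) : 0 ≤ cs β α k - cs β α (k + 1) := by
  have ha : Antitone (fun k => cs β α k - cs β α (k + 1)) := antitone_nat_of_succ_le (cs_anti β α hβ hα h)
  have ht := (cs_tendsto β α hβ hα).sub ((cs_tendsto β α hβ hα).comp (Filter.tendsto_add_atTop_nat 1))
  rw [sub_zero] at ht
  exact ha.le_of_tendsto ht k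

theorem iter_id_mul (g : ℂ → ℂ) (hg : AnalyticAt ℂ g 0) (k : ℕ) :
    iteratedDeriv k (fun z => z * deriv g z) 0 = k * iteratedDeriv k g 0 := by
  rw [iteratedDeriv_fun_mul (f := fun z : ℂ => z) contDiffAt_id hg.deriv.contDiffAt]
  rcases k with _ | k
  · simp
  · rw [Finset.sum_eq_single 1]
    · rw [← iteratedDeriv_succ']; simp
    · intro i _ hi
      have := iteratedDeriv_fun_pow_zero (𝕜 := ℂ) (n := i) (m := 1)
      simp only [pow_one] at this
      rw [show iteratedDeriv i (fun z : ℂ => z) 0 = 0 by rw [this]; simp [hi]]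
      simp
    · simp

theorem stmt_5 (M α : ℝ) (hM : 0 < M) (hα0 : 0 < α) (hα1 : α ≤ 1)
    (hMα : M - α + 1 ≤ 3 * (1 + α) / (6 * α + 4))
    (F : ℂ → ℂ)
    (hF : DifferentiableOn ℂ F (ball 0 1))
    (hF0 : F 0 = 0) (hdF0 : deriv F 0 = 1)
    (hineq : ∀ z ∈ ball (0:ℂ) 1,
      ((1 - α) * deriv F z + α * z * deriv (deriv F) z).re > -M) :
    ∀ z ∈ ball (0:ℂ) 1, (if z = 0 then (1 : ℂ) else F z / z).re > 1 / 2 := by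
  intro z hz
  by_cases hz0 : z = 0
  · simp [hz0]; norm_num
  rw [if_neg hz0]
  obtain ⟨β, hβ⟩ : ∃ β, β = M - α + 1 := ⟨_, rfl⟩
  have hβ0 : 0 < β := by linarith
  have hβ1 : β * (6 * α + 4) ≤ 3 * (1 + α) := by
    rw [← hβ] at hMα
    rwa [le_div_iff₀ (by positivity)] at hMα
  have hF1 : DifferentiableOn ℂ (deriv F) (ball 0 1) := hF.deriv isOpen_ball
  have hF2 : DifferentiableOn ℂ (deriv (deriv F)) (ball 0 1) := hF1.deriv isOpen_ball
  have h0 : (0:ℂ) ∈ ball (0:ℂ) 1 := by simp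
  have hA1 : AnalyticAt ℂ (deriv F) 0 := hF1.analyticAt (isOpen_ball.mem_nhds h0)
  have hA2 : AnalyticAt ℂ (deriv (deriv F)) 0 := hF2.analyticAt (isOpen_ball.mem_nhds h0)
  set q : ℂ → ℂ := fun z => ((1 - α) * deriv F z + α * (z * deriv (deriv F) z)) + M with hqdef
  have hq : DifferentiableOn ℂ q (ball 0 1) := by
    simp only [hqdef]; fun_prop
  have hpos : ∀ z ∈ ball (0:ℂ) 1, 0 < (q z).re := by
    intro z hz
    have := hineq z hz
    simp only [hqdef]
    rw [Complex.add_re, Complex.ofReal_re, ← mul_assoc]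
    linarith
  have hq0 : q 0 = β := by simp [hqdef, hdF0, hβ]; ring
  -- coefficient relation
  have hcoef : ∀ k : ℕ, k ≠ 0 → iteratedDeriv k q 0 = (1 - α + α * k) * iteratedDeriv (k + 1) F 0 := by
    intro k hk
    have c1 : ContDiffAt ℂ k (fun z => (1 - (α:ℂ)) * deriv F z) 0 :=
      contDiffAt_const.mul hA1.contDiffAt
    have c2 : ContDiffAt ℂ k (fun z => (α:ℂ) * (z * deriv (deriv F) z)) 0 :=
      contDiffAt_const.mul (contDiffAt_id.mul hA2.contDiffAt)
    rw [hqdef, iteratedDeriv_fun_add (c1.add c2) contDiffAt_const, iteratedDeriv_fun_add c1 c2,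
      iteratedDeriv_const_mul_field, iteratedDeriv_const_mul_field, iter_id_mul _ hA1,
      iteratedDeriv_const, if_neg hk, iteratedDeriv_succ']
    ring
  have hzn : ‖z‖ < 1 := by simpa using hz
  obtain ⟨A, ρ, hρ0, hρ1, hAn, hA0, hA⟩ := exists_A q hq hpos z hzn
  set t : ℕ → ℂ := fun k => (k.factorial : ℂ)⁻¹ * (z ^ k * iteratedDeriv k q 0) with ht
  set τ : ℕ → ℝ := fun N => (∑ k ∈ Finset.range N, t k).re with hτ
  have hlow := abel_lower (cs β α) (cs_anti β α hβ0 hα0 hβ1) τ A ρ hρ0 hρ1 hAn hA0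
    (cs_nonneg_diff β α hβ0 hα0 hβ1) (by simp [hτ]) hA
  have hA1v : A 1 = β := by
    have := hA 0
    simp [hA0] at this
    rw [← this]; simp [ht, hq0]
  have hs1 : HasSum t (q z) := by
    simpa [ht] using Complex.hasSum_taylorSeries_on_ball hq hz
  have hs2 : HasSum (fun n : ℕ => (n.factorial : ℂ)⁻¹ * (z ^ n * iteratedDeriv n F 0)) (F z) := by
    simpa using Complex.hasSum_taylorSeries_on_ball hF hz
  have hs3 : HasSum (fun k : ℕ => (((k+1).factorial : ℂ)⁻¹ * (z ^ (k+1) * iteratedDeriv (k+1) F 0)) * (2 * β / z))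
      (F z * (2 * β / z)) := by
    have := (hasSum_nat_add_iff' 1).2 hs2
    simp only [Finset.sum_range_one, iteratedDeriv_zero, hF0, mul_zero, sub_zero] at this
    exact this.mul_right _
  have hterm : ∀ k : ℕ, (((k+1).factorial : ℂ)⁻¹ * (z ^ (k+1) * iteratedDeriv (k+1) F 0)) * (2 * β / z)
      = (cs β α k : ℂ) * t k + if k = 0 then (β:ℂ) else 0 := by
    intro k
    rcases k with _ | k
    · simp [ht, hq0, cs, iteratedDeriv_one, hdF0]
      field_simp
      ring
    · simp only [ht]
      rw [hcoef (k+1) (by omega), cs, if_neg (by omega), if_neg (by omega), Nat.factorial_succ (k+1)]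
      have hf : ((k+1).factorial : ℂ) ≠ 0 := by exact_mod_cast (k+1).factorial_ne_zero
      have hd : (1 + (α:ℂ) * k) ≠ 0 := by
        have : (0:ℝ) < 1 + α * k := by positivity
        exact_mod_cast this.ne'
      have hk2 : ((k:ℂ) + 1 + 1) ≠ 0 := by exact_mod_cast (k+1).succ_ne_zero
      push_cast
      rw [show (1 + (α:ℂ) * (k + 1 - 1)) = 1 + α * k by ring,
        show (1 - (α:ℂ) + α * (k + 1)) = 1 + α * k by ring]
      generalize 1 + (α:ℂ) * k = D at hd ⊢
      field_simp
      ring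
  have hs4 : HasSum (fun k : ℕ => (cs β α k : ℂ) * t k) (F z * (2 * β / z) - β) := by
    have := hs3.sub (hasSum_ite_eq (0:ℕ) (β:ℂ))
    have e : (fun k : ℕ => (cs β α k : ℂ) * t k) = fun b : ℕ =>
      (((b+1).factorial : ℂ)⁻¹ * (z ^ (b+1) * iteratedDeriv (b+1) F 0)) * (2 * β / z)
        - if b = 0 then (β:ℂ) else 0 := by
      funext k
      rw [hterm k, add_sub_cancel_right]
    rw [e]
    exact this
  have hl1 := (Complex.continuous_re.tendsto _).comp (hs4.tendsto_sum_nat.comp (Filter.tendsto_add_atTop_nat 1))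
  have hl2 := (((cs_tendsto β α hβ0 hα0).mul ((Complex.continuous_re.tendsto _).comp hs1.tendsto_sum_nat))).comp
    (Filter.tendsto_add_atTop_nat 1)
  have hfin := ge_of_tendsto' (b := (1 - ρ) * (cs β α 0 - cs β α 1) * β) (hl1.sub hl2) (by
    intro N
    have h1 := hlow N
    rw [hA1v] at h1
    have h2 := mul_nonneg (mul_nonneg hρ0 (cs_nonneg_diff β α hβ0 hα0 hβ1 N)) (hAn (N+1))
    have h3 : (∑ k ∈ Finset.range (N + 1), (cs β α k : ℂ) * t k).re
        = ∑ k ∈ Finset.range (N + 1), cs β α k * (τ (k + 1) - τ k) := by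
      rw [Complex.re_sum]
      refine Finset.sum_congr rfl fun k _ => ?_
      simp [hτ, Finset.sum_range_succ]
    simp only [Function.comp]
    rw [h3]
    simp only [hτ] at h1 ⊢
    linarith)
  have hc0 : 0 < cs β α 0 - cs β α 1 := by
    simp [cs]
    nlinarith
  have hp : 0 < (1 - ρ) * (cs β α 0 - cs β α 1) * β := by
    have := sub_pos.2 hρ1
    positivity
  have he : (F z * (2 * β / z) - β).re = 2 * β * (F z / z).re - β := by
    rw [show F z * (2 * (β:ℂ) / z) = ((2 * β : ℝ) : ℂ) * (F z / z) by push_cast; ring]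
    rw [Complex.sub_re, Complex.re_ofReal_mul, Complex.ofReal_re]
  rw [zero_mul, sub_zero, he] at hfin
  have : 0 < β * (2 * (F z / z).re - 1) := by nlinarith
  have := pos_of_mul_pos_right this hβ0.le
  linarith
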